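/- The proper subvarieties of the variety I = var{x²y = xy², x²yz = 0, xy = yx} are exactly the following: I_n = var{x²yz = x₁x₂⋯xₙ = 0, x²y = xy², xy = yx} for n ≥ 4; J = var{x²yz = x³ = 0, x²y = xy², xy = yx}; J_n = var{x²yz = x³ = x₁x₂⋯xₙ = 0, x²y = xy², xy = yx} for n ≥ 4; K = var{x²y = 0, xy = yx}; K_n = var{x²y = x₁x₂⋯xₙ = 0, xy = yx} for n ≥ 3; L = var{x² = 0, xy = yx}; and L_n = var{x² = x₁x₂⋯xₙ = 0, xy = yx} for n ≥ 1. -/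

import Mathlib

/-!
Formalization framework: semigroup varieties as Galois-closed equational theories
over the free semigroup on countably many letters.  A variety is represented by
its equational theory; the order `V ≤ W` ("V is a subvariety of W") is reverse
inclusion of theories.  `Com` is the lattice of commutative semigroup varieties,
realized as the subtype of varieties whose theory contains the commutative law.
-/

open FreeSemigroup

/-- Words: elements of the free semigroup over a countably infinite alphabet. -/
abbrev Word : Type := FreeSemigroup ℕ

/-- A semigroup identity `u = v`. -/
abbrev SgId : Type := Word × Word

/-- `spow a n = a ^ (n + 1)` in any (multiplicative) semigroup. -/
def spow {M : Type*} [Mul M] (a : M) : ℕ → M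
  | 0 => a
  | n + 1 => a * spow a n

/-- A semigroup `S` satisfies the identity `e.1 = e.2`. -/
def SatS (S : Type) [Semigroup S] (e : SgId) : Prop :=
  ∀ σ : ℕ → S, FreeSemigroup.lift σ e.1 = FreeSemigroup.lift σ e.2

/-- `S` is a model of the set of identities `E`. -/
def Models (S : Type) [Semigroup S] (E : Set SgId) : Prop :=
  ∀ e ∈ E, SatS S e

/-- The equational theory generated by `E`: all identities holding in every
model of `E` (by Birkhoff's theorem this is exactly deductive closure). -/
def eqTh (E : Set SgId) : Set SgId :=
  { e | ∀ (S : Type) [Semigroup S], Models S E → SatS S e }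

theorem subset_eqTh (E : Set SgId) : E ⊆ eqTh E := by
  intro e he S _ hS
  exact hS e he

theorem eqTh_mono {E F : Set SgId} (h : E ⊆ F) : eqTh E ⊆ eqTh F := by
  intro e he S _ hS
  exact he S fun e' he' => hS e' (h he')

theorem eqTh_idem (E : Set SgId) : eqTh (eqTh E) = eqTh E := by
  refine Set.Subset.antisymm ?_ (subset_eqTh _)
  intro e he S _ hS
  exact he S fun e' he' => he' S hS

/-- A semigroup variety, given by its (Galois-closed) equational theory. -/
structure SgVariety where
  th : Set SgId
  closed : eqTh th = th

theorem SgVariety.ext' {V W : SgVariety} (h : V.th = W.th) : V = W := by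
  cases V; cases W; cases h; rfl

/-- The variety defined by a set of identities. -/
def varOf (E : Set SgId) : SgVariety :=
  ⟨eqTh E, eqTh_idem E⟩

/-- `V ≤ W` iff `V` is a subvariety of `W`, i.e. the theory of `W` is contained
in the theory of `V`. -/
instance : PartialOrder SgVariety where
  le V W := W.th ⊆ V.th
  le_refl V := Set.Subset.refl _
  le_trans a b c h1 h2 := Set.Subset.trans h2 h1
  le_antisymm a b h1 h2 := SgVariety.ext' (Set.Subset.antisymm h2 h1)

/-- The lattice **SEM** of all semigroup varieties: join is intersection of
theories; meet is the variety defined by the union of the theories. -/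
instance : Lattice SgVariety :=
  { (inferInstance : PartialOrder SgVariety) with
    sup := fun V W =>
      ⟨V.th ∩ W.th, by
        refine Set.Subset.antisymm (Set.subset_inter ?_ ?_) (subset_eqTh _)
        · exact (eqTh_mono Set.inter_subset_left).trans (le_of_eq V.closed)
        · exact (eqTh_mono Set.inter_subset_right).trans (le_of_eq W.closed)⟩
    le_sup_left := fun V W => Set.inter_subset_left
    le_sup_right := fun V W => Set.inter_subset_right
    sup_le := fun V W U h1 h2 => Set.subset_inter h1 h2
    inf := fun V W => varOf (V.th ∪ W.th)
    inf_le_left := fun V W => Set.subset_union_left.trans (subset_eqTh _)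
    inf_le_right := fun V W => Set.subset_union_right.trans (subset_eqTh _)
    le_inf := fun U V W h1 h2 =>
      (eqTh_mono (Set.union_subset h1 h2)).trans (le_of_eq U.closed) }

/-- The letters `x`, `y`, `z`. -/
def xw : Word := FreeSemigroup.of 0
def yw : Word := FreeSemigroup.of 1
def zw : Word := FreeSemigroup.of 2

/-- The commutative law `xy = yx`. -/
def commId : SgId := (xw * yw, yw * xw)

/-- The lattice **Com**: commutative semigroup varieties. -/
abbrev ComVariety : Type := { V : SgVariety // commId ∈ V.th }

instance : Lattice ComVariety :=
  { (inferInstance : PartialOrder ComVariety) with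
    sup := fun V W => ⟨V.1 ⊔ W.1, ⟨V.2, W.2⟩⟩
    le_sup_left := fun V W => @le_sup_left SgVariety _ V.1 W.1
    le_sup_right := fun V W => @le_sup_right SgVariety _ V.1 W.1
    sup_le := fun V W U h1 h2 => @sup_le SgVariety _ V.1 W.1 U.1 h1 h2
    inf := fun V W => ⟨V.1 ⊓ W.1, subset_eqTh _ (Set.mem_union_left _ V.2)⟩
    inf_le_left := fun V W => @inf_le_left SgVariety _ V.1 W.1
    inf_le_right := fun V W => @inf_le_right SgVariety _ V.1 W.1
    le_inf := fun U V W h1 h2 => @le_inf SgVariety _ U.1 V.1 W.1 h1 h2 }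

/-- The trivial variety `T`. -/
def trivialVar : SgVariety := varOf Set.univ

/-- The variety `COM` of all commutative semigroups. -/
def COMvar : SgVariety := varOf {commId}

/-- The variety `SL` of semilattices. -/
def SLvar : SgVariety := varOf {commId, (xw * xw, xw)}

/-- `C_m = var{xᵐ = xᵐ⁺¹, xy = yx}` for `m ≥ 1`, and `C_0 = T`. -/
def Cvar : ℕ → SgVariety
  | 0 => trivialVar
  | m + 1 => varOf {commId, (spow xw m, spow xw (m + 1))}

def Tcom : ComVariety := ⟨trivialVar, subset_eqTh _ (Set.mem_univ _)⟩
def COMcom : ComVariety := ⟨COMvar, subset_eqTh _ rfl⟩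
def SLcom : ComVariety := ⟨SLvar, subset_eqTh _ (Set.mem_insert _ _)⟩
def Ccom (m : ℕ) : ComVariety :=
  ⟨Cvar m, by
    cases m with
    | zero => exact subset_eqTh _ (Set.mem_univ _)
    | succ m => exact subset_eqTh _ (Set.mem_insert _ _)⟩

/-- A semigroup (nonempty, with the given multiplication) is a group. -/
def IsGroupS (S : Type) [Semigroup S] : Prop :=
  ∃ e : S, (∀ a : S, e * a = a ∧ a * e = a) ∧ ∀ a : S, ∃ b : S, a * b = e ∧ b * a = e

/-- A nilsemigroup: there is a zero element and some power of every element is zero. -/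
def IsNilS (S : Type) [Semigroup S] : Prop :=
  ∃ z : S, (∀ a : S, z * a = z ∧ a * z = z) ∧ ∀ a : S, ∃ n : ℕ, spow a n = z

/-- A group variety: all its (nonempty) members are groups. -/
def IsGroupVariety (V : SgVariety) : Prop :=
  ∀ (S : Type) [Semigroup S], Nonempty S → Models S V.th → IsGroupS S

/-- A nil-variety: all its (nonempty) members are nilsemigroups. -/
def IsNilVariety (V : SgVariety) : Prop :=
  ∀ (S : Type) [Semigroup S], Nonempty S → Models S V.th → IsNilS S

/-- A combinatorial variety: all groups in it are singletons. -/
def IsCombinatorial (V : SgVariety) : Prop :=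
  ∀ (S : Type) [Semigroup S], Models S V.th → IsGroupS S → Subsingleton S

/-- A periodic variety: satisfies `xⁿ = xⁿ⁺ᵏ` for some `n, k ≥ 1`. -/
def IsPeriodic (V : SgVariety) : Prop :=
  ∃ n k : ℕ, (spow xw n, spow xw (n + k + 1)) ∈ V.th

/-- The letter `k` occurs in the word `w`. -/
def occursIn (k : ℕ) (w : Word) : Prop := k = w.head ∨ k ∈ w.tail

/-- `S` satisfies the identity `w = 0` (i.e. the system `wx = xw = w`, `x` fresh):
every value of `w` in `S` is a (two-sided) zero element. -/
def SatZeroS (S : Type) [Semigroup S] (w : Word) : Prop :=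
  ∀ (σ : ℕ → S) (a : S),
    FreeSemigroup.lift σ w * a = FreeSemigroup.lift σ w ∧
      a * FreeSemigroup.lift σ w = FreeSemigroup.lift σ w

/-- The variety `V` satisfies the identity `w = 0`. -/
def VSatZero (V : SgVariety) (w : Word) : Prop :=
  ∀ (S : Type) [Semigroup S], Models S V.th → SatZeroS S w

/-- The words `x²`, `x³`, `x²y`, `xy²`, `x²yz`. -/
def w_xx : Word := xw * xw
def w_xxx : Word := xw * xw * xw
def w_xxy : Word := xw * xw * yw
def w_xyy : Word := xw * yw * yw
def w_xxyz : Word := xw * xw * yw * zw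

/-- The identity `x²y = xy²`. -/
def idQ : SgId := (w_xxy, w_xyy)

/-- The pair of identities expressing `w = 0`, with `k` a fresh letter. -/
def zeroPair (w : Word) (k : ℕ) : Set SgId :=
  {(w * FreeSemigroup.of k, w), (FreeSemigroup.of k * w, w)}

/-- `xprodTo n = x₁x₂⋯xₙ` (for `n ≥ 1`), on the letters `0, …, n-1`. -/
def xprodTo : ℕ → Word
  | 0 => FreeSemigroup.of 0
  | 1 => FreeSemigroup.of 0
  | n + 2 => xprodTo (n + 1) * FreeSemigroup.of (n + 1)

/-- `I = var{x²y = xy², x²yz = 0, xy = yx}`. -/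
def Ivar : SgVariety := varOf ({commId, idQ} ∪ zeroPair w_xxyz 3)

/-- `K = var{x²y = 0, xy = yx}`. -/
def Kvar : SgVariety := varOf ({commId} ∪ zeroPair w_xxy 2)

/-- `L = var{x² = 0, xy = yx}`. -/
def Lvar : SgVariety := varOf ({commId} ∪ zeroPair w_xx 1)

/-- `I_n = var{x²yz = x₁⋯xₙ = 0, x²y = xy², xy = yx}`. -/
def Ivarn (n : ℕ) : SgVariety :=
  varOf ({commId, idQ} ∪ zeroPair w_xxyz 3 ∪ zeroPair (xprodTo n) n)

/-- `J = var{x²yz = x³ = 0, x²y = xy², xy = yx}`. -/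
def Jvar : SgVariety := varOf ({commId, idQ} ∪ zeroPair w_xxyz 3 ∪ zeroPair w_xxx 1)

/-- `J_n = var{x²yz = x³ = x₁⋯xₙ = 0, x²y = xy², xy = yx}`. -/
def Jvarn (n : ℕ) : SgVariety :=
  varOf ({commId, idQ} ∪ zeroPair w_xxyz 3 ∪ zeroPair w_xxx 1 ∪ zeroPair (xprodTo n) n)

/-- `K_n = var{x²y = x₁⋯xₙ = 0, xy = yx}`. -/
def Kvarn (n : ℕ) : SgVariety :=
  varOf ({commId} ∪ zeroPair w_xxy 2 ∪ zeroPair (xprodTo n) n)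

/-- `L_n = var{x² = x₁⋯xₙ = 0, xy = yx}`. -/
def Lvarn (n : ℕ) : SgVariety :=
  varOf ({commId} ∪ zeroPair w_xx 1 ∪ zeroPair (xprodTo n) n)

/-- Generators of `ZR(U)`: the commutative law together with all 0-reduced
identities (in the form of the corresponding identity pairs) holding in `U`. -/
def ZRgen (U : SgVariety) : Set SgId :=
  {commId} ∪ { e : SgId | ∃ (w : Word) (k : ℕ), ¬ occursIn k w ∧ VSatZero U w ∧
      (e = (w * FreeSemigroup.of k, w) ∨ e = (FreeSemigroup.of k * w, w)) }

/-- `ZR(U)`: the variety given by the commutative law and all 0-reduced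
identities holding in `U`. -/
def ZRvar (U : SgVariety) : SgVariety := varOf (ZRgen U)

def Icom : ComVariety := ⟨Ivar, subset_eqTh _ (Set.mem_union_left _ (Set.mem_insert _ _))⟩

def ZRcom (U : SgVariety) : ComVariety :=
  ⟨ZRvar U, subset_eqTh _ (Set.mem_union_left _ rfl)⟩

/-- All nilsemigroups in `V` are nilpotent of degree ≤ n, i.e. satisfy `x₁⋯xₙ = 0`. -/
def HasDegLe (V : SgVariety) (n : ℕ) : Prop :=
  ∀ (S : Type) [Semigroup S], Nonempty S → Models S V.th → IsNilS S → SatZeroS S (xprodTo n)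

/-- `deg V = d` (with `d = ⊤` meaning infinite degree). -/
def DegIs (V : SgVariety) (d : ℕ∞) : Prop :=
  (∃ n : ℕ, 0 < n ∧ d = (n : ℕ∞) ∧ IsLeast {m : ℕ | 0 < m ∧ HasDegLe V m} n) ∨
    (d = ⊤ ∧ ∀ n : ℕ, 0 < n → ¬ HasDegLe V n)

/-- Upper-modular element of a lattice. -/
def IsUpperModular {L : Type*} [Lattice L] (a : L) : Prop :=
  ∀ b c : L, b ≤ a → a ⊓ (b ⊔ c) = b ⊔ (a ⊓ c)

/-- Codistributive element of a lattice. -/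
def IsCodistributive {L : Type*} [Lattice L] (a : L) : Prop :=
  ∀ b c : L, a ⊓ (b ⊔ c) = (a ⊓ b) ⊔ (a ⊓ c)

/-- Costandard element of a lattice. -/
def IsCostandard {L : Type*} [Lattice L] (a : L) : Prop :=
  ∀ b c : L, (a ⊓ b) ⊔ c = (a ⊔ c) ⊓ (b ⊔ c)

/-- Modular element of a lattice. -/
def IsModularElt {L : Type*} [Lattice L] (a : L) : Prop :=
  ∀ b c : L, b ≤ c → (a ⊔ b) ⊓ c = (a ⊓ c) ⊔ b

/-- Neutral element of a lattice, via the median characterization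
(equivalent to: every triple containing `a` generates a distributive
sublattice; Grätzer, "Lattice Theory: Foundation", Theorem 254). -/
def IsNeutralElt {L : Type*} [Lattice L] (a : L) : Prop :=
  ∀ b c : L, (a ⊓ b) ⊔ (b ⊓ c) ⊔ (c ⊓ a) = (a ⊔ b) ⊓ (b ⊔ c) ⊓ (c ⊔ a)

/-! ### Words as multisets of letters -/

/-- The multiset of letters of a word. -/
def Word.letters (w : Word) : Multiset ℕ := w.head ::ₘ (w.tail : Multiset ℕ)

namespace Word

theorem letters_of (k : ℕ) : letters (FreeSemigroup.of k) = {k} := rfl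

theorem letters_mul (u v : Word) : letters (u * v) = letters u + letters v := by
  simp only [letters, FreeSemigroup.head_mul, FreeSemigroup.tail_mul, ← Multiset.coe_add,
    ← Multiset.cons_coe, Multiset.cons_add]

theorem exists_letters_eq {m : Multiset ℕ} (hm : m ≠ 0) : ∃ w : Word, letters w = m := by
  induction m using Quotient.inductionOn with
  | h l =>
    cases l with
    | nil => exact absurd rfl hm
    | cons h t => exact ⟨⟨h, t⟩, rfl⟩

theorem letters_xx : letters w_xx = {0, 0} := rfl
theorem letters_xxx : letters w_xxx = {0, 0, 0} := rfl
theorem letters_xxy : letters w_xxy = {0, 0, 1} := rfl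
theorem letters_xyy : letters w_xyy = {0, 1, 1} := rfl
theorem letters_xxyz : letters w_xxyz = {0, 0, 1, 2} := rfl

theorem letters_xprodTo_succ (n : ℕ) : letters (xprodTo (n + 1)) = Multiset.range (n + 1) := by
  induction n with
  | zero => rfl
  | succ n ih =>
    rw [xprodTo, letters_mul, ih, letters_of, Multiset.range_succ (n + 1), add_comm,
      Multiset.singleton_add]

theorem letters_xprodTo {n : ℕ} (hn : 1 ≤ n) : letters (xprodTo n) = Multiset.range n := by
  obtain ⟨m, rfl⟩ := Nat.exists_eq_add_of_le' hn
  exact letters_xprodTo_succ m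

theorem lift_congr {S : Type} [Semigroup S] {σ τ : ℕ → S} {w : Word}
    (h : ∀ k ∈ letters w, σ k = τ k) : FreeSemigroup.lift σ w = FreeSemigroup.lift τ w := by
  induction w using FreeSemigroup.recOnMul with
  | ih1 x => simpa using h x (by simp [letters_of])
  | ih2 x y _ ih =>
    rw [FreeSemigroup.lift_of_mul, FreeSemigroup.lift_of_mul,
      h x (by simp [letters_mul, letters_of]),
      ih fun k hk => h k (by simp [letters_mul, hk])]

theorem coe_lift {S : Type} [CommSemigroup S] (σ : ℕ → S) (w : Word) :
    ((FreeSemigroup.lift σ w : S) : WithOne S) =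
      ((letters w).map fun k => (σ k : WithOne S)).prod := by
  induction w using FreeSemigroup.recOnMul with
  | ih1 x => simp [letters_of]
  | ih2 x y _ ih =>
    rw [FreeSemigroup.lift_of_mul, WithOne.coe_mul, ih, letters_mul, letters_of]
    simp

end Word

/-! ### Zero words in commutative semigroups -/

section Comm

variable {S : Type} [Semigroup S]

open Word

theorem lift_eq_of_letters_eq (hc : ∀ a b : S, a * b = b * a) {u v : Word}
    (h : letters u = letters v) (σ : ℕ → S) :
    FreeSemigroup.lift σ u = FreeSemigroup.lift σ v := by
  let _ : CommSemigroup S := { ‹Semigroup S› with mul_comm := hc }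
  apply WithOne.coe_injective
  have hu := coe_lift σ u
  rw [h] at hu
  exact hu.trans (coe_lift σ v).symm

/-- A word all of whose values are zero makes every word zero that contains a letter-for-letter
substitution instance of it. -/
theorem SatZeroS.of_map_le (hc : ∀ a b : S, a * b = b * a) {u w : Word} (f : ℕ → ℕ)
    (h : (letters w).map f ≤ letters u) (hw : SatZeroS S w) : SatZeroS S u := by
  have key : ∀ σ : ℕ → S, FreeSemigroup.lift σ u = FreeSemigroup.lift (σ ∘ f) w := by
    intro σ
    obtain ⟨t, ht⟩ := Multiset.le_iff_exists_add.mp h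
    have hmap : FreeSemigroup.lift (σ ∘ f) w =
        FreeSemigroup.lift σ (FreeSemigroup.map f w) := by
      clear h hw ht
      induction w using FreeSemigroup.recOnMul with
      | ih1 x => rfl
      | ih2 x y _ ih => rw [map_mul, map_mul, map_mul, ih]; rfl
    have hletters : letters (FreeSemigroup.map f w) = (letters w).map f := by
      clear h hw ht hmap
      induction w using FreeSemigroup.recOnMul with
      | ih1 x => rfl
      | ih2 x y _ ih => rw [map_mul, letters_mul, letters_mul, ih, Multiset.map_add]; rfl
    by_cases h0 : t = 0
    · subst h0
      rw [hmap]
      exact lift_eq_of_letters_eq hc (by rw [ht, hletters, add_zero]) σ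
    · obtain ⟨v, rfl⟩ := exists_letters_eq h0
      rw [lift_eq_of_letters_eq hc (v := FreeSemigroup.map f w * v)
        (by rw [ht, letters_mul, hletters]) σ, map_mul, ← hmap, (hw _ _).1]
  intro σ a
  rw [key]
  exact hw _ a

theorem SatZeroS.lift_eq {u v : Word} (hu : SatZeroS S u) (hv : SatZeroS S v) (σ τ : ℕ → S) :
    FreeSemigroup.lift σ u = FreeSemigroup.lift τ v :=
  (hu σ (FreeSemigroup.lift τ v)).1.symm.trans (hv τ (FreeSemigroup.lift σ u)).2

end Comm

/-! ### Models of the defining identities -/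

section Models

open Word

theorem models_union {S : Type} [Semigroup S] {E F : Set SgId} :
    Models S (E ∪ F) ↔ Models S E ∧ Models S F :=
  ⟨fun h => ⟨fun e he => h e (Or.inl he), fun e he => h e (Or.inr he)⟩,
    fun h e he => he.elim (h.1 e) (h.2 e)⟩

theorem models_insert {S : Type} [Semigroup S] {e : SgId} {F : Set SgId} :
    Models S (insert e F) ↔ SatS S e ∧ Models S F := by
  simp [Models]

theorem models_singleton {S : Type} [Semigroup S] {e : SgId} : Models S {e} ↔ SatS S e := by
  simp [Models]

theorem satS_commId {S : Type} [Semigroup S] : SatS S commId ↔ ∀ a b : S, a * b = b * a := by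
  refine ⟨fun h a b => ?_, fun h σ => ?_⟩
  · simpa [commId, xw, yw] using h fun k => if k = 0 then a else b
  · simpa [commId, xw, yw] using h _ _

theorem models_zeroPair {S : Type} [Semigroup S] {w : Word} {k : ℕ} (hk : k ∉ letters w) :
    Models S (zeroPair w k) ↔ SatZeroS S w := by
  rw [zeroPair, models_insert, models_singleton]
  refine ⟨fun h σ a => ?_, fun h => ⟨fun σ => ?_, fun σ => ?_⟩⟩
  · have hw : FreeSemigroup.lift (Function.update σ k a) w = FreeSemigroup.lift σ w :=
      lift_congr fun j hj => Function.update_of_ne (ne_of_mem_of_not_mem hj hk) _ _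
    simpa [SatS, hw] using And.intro (h.1 (Function.update σ k a)) (h.2 (Function.update σ k a))
  · simpa using (h σ (σ k)).1
  · simpa using (h σ (σ k)).2

theorem models_eqTh {S : Type} [Semigroup S] {E : Set SgId} : Models S (eqTh E) ↔ Models S E :=
  ⟨fun h e he => h e (subset_eqTh E he), fun h _ he => he S h⟩

theorem mem_th_iff {V : SgVariety} {e : SgId} :
    e ∈ V.th ↔ ∀ (S : Type) [Semigroup S], Models S V.th → SatS S e := by
  conv_lhs => rw [← V.closed]
  rfl

theorem le_varOf_iff {V : SgVariety} {E : Set SgId} :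
    V ≤ varOf E ↔ ∀ (S : Type) [Semigroup S], Models S V.th → Models S E := by
  refine ⟨fun h S _ hS e he => hS e (h (subset_eqTh E he)), fun h e he => ?_⟩
  exact mem_th_iff.2 fun S _ hS => he S (h S hS)

/-- The semigroup `S` is a member of the variety `I`. -/
structure InI (S : Type) [Semigroup S] : Prop where
  comm : ∀ a b : S, a * b = b * a
  satQ : SatS S idQ
  zero : SatZeroS S w_xxyz

theorem models_I {S : Type} [Semigroup S] :
    Models S ({commId, idQ} ∪ zeroPair w_xxyz 3) ↔ InI S := by
  rw [models_union, models_insert, models_singleton, satS_commId,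
    models_zeroPair (by rw [letters_xxyz]; decide)]
  exact ⟨fun h => ⟨h.1.1, h.1.2, h.2⟩, fun h => ⟨⟨h.1, h.2⟩, h.3⟩⟩

theorem inI_of_satZeroS_xxy {S : Type} [Semigroup S] (hc : ∀ a b : S, a * b = b * a)
    (h : SatZeroS S w_xxy) : InI S where
  comm := hc
  satQ σ := h.lift_eq (h.of_map_le (u := w_xyy) hc (fun k => 1 - k) (by
    rw [letters_xxy, letters_xyy]; decide)) σ σ
  zero := h.of_map_le hc id (by rw [letters_xxy, letters_xxyz]; decide)

theorem models_K {S : Type} [Semigroup S] :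
    Models S ({commId} ∪ zeroPair w_xxy 2) ↔ InI S ∧ SatZeroS S w_xxy := by
  rw [models_union, models_singleton, satS_commId,
    models_zeroPair (by rw [letters_xxy]; decide)]
  exact ⟨fun h => ⟨inI_of_satZeroS_xxy h.1 h.2, h.2⟩, fun h => ⟨h.1.comm, h.2⟩⟩

theorem satZeroS_xxy_of_xx {S : Type} [Semigroup S] (hc : ∀ a b : S, a * b = b * a)
    (h : SatZeroS S w_xx) : SatZeroS S w_xxy :=
  h.of_map_le hc id (by rw [letters_xx, letters_xxy]; decide)

theorem satZeroS_xxx_of_xxy {S : Type} [Semigroup S] (hc : ∀ a b : S, a * b = b * a)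
    (h : SatZeroS S w_xxy) : SatZeroS S w_xxx :=
  h.of_map_le hc (fun _ => 0) (by rw [letters_xxx, letters_xxy]; decide)

theorem satZeroS_xprodTo_of_le {S : Type} [Semigroup S] (hc : ∀ a b : S, a * b = b * a)
    {m n : ℕ} (hm : 1 ≤ m) (hmn : m ≤ n) (h : SatZeroS S (xprodTo m)) :
    SatZeroS S (xprodTo n) :=
  h.of_map_le hc id (by
    rw [letters_xprodTo hm, letters_xprodTo (hm.trans hmn), Multiset.map_id]
    exact Multiset.range_le.2 hmn)

theorem satZeroS_xx_of_xprodTo {S : Type} [Semigroup S] (hc : ∀ a b : S, a * b = b * a)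
    {n : ℕ} (hn : 1 ≤ n) (hn2 : n ≤ 2) (h : SatZeroS S (xprodTo n)) : SatZeroS S w_xx :=
  (satZeroS_xprodTo_of_le hc hn hn2 h).of_map_le hc (fun _ => 0) (by
    rw [letters_xprodTo (by norm_num), letters_xx]; decide)

theorem satZeroS_xxy_of_xprodTo {S : Type} [Semigroup S] (hc : ∀ a b : S, a * b = b * a)
    {n : ℕ} (hn : 1 ≤ n) (hn3 : n ≤ 3) (h : SatZeroS S (xprodTo n)) : SatZeroS S w_xxy :=
  (satZeroS_xprodTo_of_le hc hn hn3 h).of_map_le hc (fun k => k - 1) (by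
    rw [letters_xprodTo (by norm_num), letters_xxy]; decide)

theorem models_L {S : Type} [Semigroup S] :
    Models S ({commId} ∪ zeroPair w_xx 1) ↔ InI S ∧ SatZeroS S w_xx := by
  rw [models_union, models_singleton, satS_commId,
    models_zeroPair (by rw [letters_xx]; decide)]
  exact ⟨fun h => ⟨inI_of_satZeroS_xxy h.1 (satZeroS_xxy_of_xx h.1 h.2), h.2⟩,
    fun h => ⟨h.1.comm, h.2⟩⟩

theorem models_J {S : Type} [Semigroup S] :
    Models S ({commId, idQ} ∪ zeroPair w_xxyz 3 ∪ zeroPair w_xxx 1) ↔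
      InI S ∧ SatZeroS S w_xxx := by
  rw [models_union, models_I, models_zeroPair (by rw [letters_xxx]; decide)]

theorem models_union_xprodTo {S : Type} [Semigroup S] {E : Set SgId} {n : ℕ} (hn : 1 ≤ n) :
    Models S (E ∪ zeroPair (xprodTo n) n) ↔ Models S E ∧ SatZeroS S (xprodTo n) := by
  rw [models_union, models_zeroPair (by simp [letters_xprodTo hn])]

end Models

/-! ### Identities in subvarieties of `I` -/

section Subvarieties

open Word

/-- The words whose vanishing distinguishes the subvarieties of `I`. -/
inductive IsTestWord : Word → Prop
  | xxyz : IsTestWord w_xxyz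
  | xx : IsTestWord w_xx
  | xxx : IsTestWord w_xxx
  | xxy : IsTestWord w_xxy
  | xprodTo (n : ℕ) : 1 ≤ n → IsTestWord (xprodTo n)

theorem exists_eq_of_not_nodup {m : Multiset ℕ} (h : ¬ m.Nodup) :
    ∃ x t, m = x ::ₘ x ::ₘ t := by
  rw [Multiset.nodup_iff_le] at h
  push Not at h
  obtain ⟨x, hx⟩ := h
  obtain ⟨t, ht⟩ := Multiset.le_iff_exists_add.mp hx
  exact ⟨x, t, by rw [ht]; simp⟩

theorem satZeroS_of_four_le_card {S : Type} [Semigroup S] (hS : InI S) {w : Word}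
    (h : ¬ (letters w).Nodup) (h4 : 4 ≤ (letters w).card) : SatZeroS S w := by
  obtain ⟨x, t, ht⟩ := exists_eq_of_not_nodup h
  have hcard : 1 < t.card := by
    rw [ht] at h4
    simp at h4
    omega
  obtain ⟨y, s, rfl⟩ := Multiset.card_pos_iff_exists_mem.1 (by omega : 0 < t.card) |>.imp
    fun y hy => Multiset.exists_cons_of_mem hy
  obtain ⟨z, r, rfl⟩ := Multiset.card_pos_iff_exists_mem.1
    (by simp at hcard; omega : 0 < s.card) |>.imp fun y hy => Multiset.exists_cons_of_mem hy
  refine hS.zero.of_map_le hS.comm (fun k => if k = 0 then x else if k = 1 then y else z) ?_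
  rw [ht, letters_xxyz]
  simp

theorem exists_map_range_eq {m : Multiset ℕ} (h : m.Nodup) :
    ∃ f g : ℕ → ℕ, (Multiset.range m.card).map f = m ∧ m.map g = Multiset.range m.card := by
  induction m using Multiset.induction with
  | empty => exact ⟨id, id, rfl, rfl⟩
  | cons a s ih =>
    obtain ⟨ha, hs⟩ := Multiset.nodup_cons.1 h
    obtain ⟨f, g, hf, hg⟩ := ih hs
    refine ⟨Function.update f s.card a, Function.update g a s.card, ?_, ?_⟩
    · rw [Multiset.card_cons, Multiset.range_succ, Multiset.map_cons, Function.update_self]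
      congr 1
      conv_rhs => rw [← hf]
      refine Multiset.map_congr rfl fun k hk => Function.update_of_ne ?_ _ _
      exact (Multiset.mem_range.1 hk).ne
    · rw [Multiset.card_cons, Multiset.range_succ, Multiset.map_cons, Function.update_self]
      congr 1
      rw [← hg]
      refine Multiset.map_congr rfl fun k hk => Function.update_of_ne ?_ _ _
      rintro rfl
      exact ha hk

theorem exists_isTestWord (u : Word) :
    ∃ w, IsTestWord w ∧ ∀ (S : Type) [Semigroup S], InI S → (SatZeroS S u ↔ SatZeroS S w) := by
  suffices H : (∀ (S : Type) [Semigroup S], InI S → SatZeroS S u) ∨ ∃ w, IsTestWord w ∧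
      ∃ f g : ℕ → ℕ, (letters w).map f = letters u ∧ (letters u).map g = letters w by
    obtain H | ⟨w, hw, f, g, hf, hg⟩ := H
    · exact ⟨_, .xxyz, fun S _ hS => iff_of_true (H S hS) hS.zero⟩
    · exact ⟨w, hw, fun S _ hS => ⟨fun h => h.of_map_le hS.comm g hg.le,
        fun h => h.of_map_le hS.comm f hf.le⟩⟩
  by_cases hn : (letters u).Nodup
  · obtain ⟨f, g, hf, hg⟩ := exists_map_range_eq hn
    have h1 : 1 ≤ (letters u).card := by simp [letters]
    exact .inr ⟨_, .xprodTo _ h1, f, g, by rw [letters_xprodTo h1, hf],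
      by rw [letters_xprodTo h1, hg]⟩
  by_cases h4 : 4 ≤ (letters u).card
  · exact .inl fun S _ hS => satZeroS_of_four_le_card hS hn h4
  obtain ⟨x, t, ht⟩ := exists_eq_of_not_nodup hn
  have hcard : t.card ≤ 1 := by
    rw [ht] at h4
    simp at h4
    omega
  rw [ht]
  right
  obtain h0 | h1 := Nat.le_one_iff_eq_zero_or_eq_one.1 hcard
  · obtain rfl := Multiset.card_eq_zero.1 h0
    exact ⟨_, .xx, fun _ => x, fun _ => 0, by simp [letters_xx], by simp [letters_xx]⟩
  · obtain ⟨y, rfl⟩ := Multiset.card_eq_one.1 h1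
    by_cases hxy : y = x
    · subst hxy
      exact ⟨_, .xxx, fun _ => y, fun _ => 0, by simp [letters_xxx], by simp [letters_xxx]⟩
    · exact ⟨_, .xxy, fun k => if k = 0 then x else y, fun k => if k = x then 0 else 1,
        by simp [letters_xxy], by simp [letters_xxy, hxy]⟩

theorem inI_of_le {V : SgVariety} (hV : V ≤ Ivar) (S : Type) [Semigroup S]
    (hS : Models S V.th) : InI S :=
  models_I.1 (le_varOf_iff.1 hV S hS)

theorem swap_mem_th {V : SgVariety} {u v : Word} (h : (u, v) ∈ V.th) : (v, u) ∈ V.th :=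
  mem_th_iff.2 fun _ _ hS σ => (hS _ h σ).symm

theorem VSatZero.of_mem_th {V : SgVariety} {u v : Word} (h : (u, v) ∈ V.th)
    (hu : VSatZero V u) : VSatZero V v := by
  intro S _ hS σ
  rw [← show FreeSemigroup.lift σ u = FreeSemigroup.lift σ v from hS _ h σ]
  exact hu S hS σ

theorem vSatZero_of_not_mem_letters {V : SgVariety} (hV : V ≤ Ivar) {u v : Word}
    (h : (u, v) ∈ V.th) {k : ℕ} (hu : k ∈ letters u) (hv : k ∉ letters v) : VSatZero V v := by
  intro S _ hS σ
  have hI := inI_of_le hV S hS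
  set z := FreeSemigroup.lift σ w_xxyz with hz
  have hlift : FreeSemigroup.lift (Function.update σ k z) u = z := by
    obtain ⟨t, ht⟩ := Multiset.exists_cons_of_mem hu
    by_cases h0 : t = 0
    · rw [lift_eq_of_letters_eq hI.comm (v := FreeSemigroup.of k) (by rw [ht, h0]; rfl)]
      simp
    · obtain ⟨w, rfl⟩ := exists_letters_eq h0
      rw [lift_eq_of_letters_eq hI.comm (v := FreeSemigroup.of k * w)
        (by rw [ht, letters_mul, letters_of, Multiset.singleton_add]),
        FreeSemigroup.lift_of_mul, Function.update_self]
      exact (hI.zero σ _).1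
  have hσ : FreeSemigroup.lift (Function.update σ k z) v = FreeSemigroup.lift σ v :=
    lift_congr fun j hj => Function.update_of_ne (ne_of_mem_of_not_mem hj hv) _ _
  rw [← hσ, ← show FreeSemigroup.lift (Function.update σ k z) u = _ from hS _ h _, hlift]
  exact hI.zero σ

theorem vSatZero_of_letters_lt {V : SgVariety} (hV : V ≤ Ivar) {u v : Word}
    (h : (u, v) ∈ V.th) (hlt : letters u < letters v) : VSatZero V u := by
  intro S _ hS σ
  have hI := inI_of_le hV S hS
  obtain ⟨t, ht⟩ := Multiset.le_iff_exists_add.mp hlt.le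
  have h0 : t ≠ 0 := by
    rintro rfl
    exact hlt.ne (by simpa using ht.symm)
  obtain ⟨w, rfl⟩ := exists_letters_eq h0
  set U := FreeSemigroup.lift σ u
  set T := FreeSemigroup.lift σ w
  have hUT : U = U * T := by
    have h1 : U = FreeSemigroup.lift σ v := hS _ h σ
    rwa [lift_eq_of_letters_eq hI.comm (v := u * w) (by rw [ht, letters_mul]), map_mul] at h1
  have hT : ∀ a, T * T * T * T * a = T * T * T * T ∧ a * (T * T * T * T) = T * T * T * T := by
    intro a
    simpa [w_xxyz, xw, yw, zw] using hI.zero (fun _ => T) a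
  have hU : U = T * T * T * T := by
    rw [← (hT U).2, ← mul_assoc, ← mul_assoc, ← mul_assoc, ← hUT, ← hUT, ← hUT, ← hUT]
  rw [hU]
  exact hT

theorem lift_xxy_eq {S : Type} [Semigroup S] (hS : InI S) {u v : Word} {x y : ℕ}
    (hu : letters u = {x, x, y}) (hv : letters v = {x, y, y}) (σ : ℕ → S) :
    FreeSemigroup.lift σ u = FreeSemigroup.lift σ v := by
  let τ : ℕ → S := fun k => if k = 0 then σ x else σ y
  rw [lift_eq_of_letters_eq hS.comm
      (v := FreeSemigroup.of x * FreeSemigroup.of x * FreeSemigroup.of y) hu,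
    lift_eq_of_letters_eq hS.comm
      (v := FreeSemigroup.of x * FreeSemigroup.of y * FreeSemigroup.of y) hv]
  simpa [idQ, w_xxy, w_xyy, xw, yw, τ] using hS.satQ τ

theorem mem_th_Ivar_iff {e : SgId} :
    e ∈ Ivar.th ↔ ∀ (S : Type) [Semigroup S], InI S → SatS S e :=
  forall₂_congr fun _ _ => imp_congr_left models_I

/-- An identity of a subvariety of `I` either holds in `I` or has both sides zero. -/
theorem mem_th_Ivar_or_vSatZero {V : SgVariety} (hV : V ≤ Ivar) {u v : Word}
    (h : (u, v) ∈ V.th) : (u, v) ∈ Ivar.th ∨ VSatZero V u := by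
  by_contra! hcon
  obtain ⟨hI, hu⟩ := hcon
  have hv : ¬ VSatZero V v := fun hv => hu (hv.of_mem_th (swap_mem_th h))
  have hmem : ∀ k, k ∈ letters u ↔ k ∈ letters v := fun k =>
    ⟨fun hk => by_contra fun hk' => hv (vSatZero_of_not_mem_letters hV h hk hk'),
      fun hk => by_contra fun hk' =>
        hu (vSatZero_of_not_mem_letters hV (swap_mem_th h) hk hk')⟩
  have hne : letters u ≠ letters v := fun he =>
    hI (mem_th_Ivar_iff.2 fun S _ hS => lift_eq_of_letters_eq hS.comm he)
  have huv : ¬ letters u ≤ letters v := fun hle =>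
    hu (vSatZero_of_letters_lt hV h (lt_of_le_of_ne hle hne))
  have hvu : ¬ letters v ≤ letters u := fun hle =>
    hv (vSatZero_of_letters_lt hV (swap_mem_th h) (lt_of_le_of_ne hle hne.symm))
  have hnu : ¬ (letters u).Nodup := fun hn => huv
    ((Multiset.le_iff_subset hn).2 fun k hk => (hmem k).1 hk)
  have hnv : ¬ (letters v).Nodup := fun hn => hvu
    ((Multiset.le_iff_subset hn).2 fun k hk => (hmem k).2 hk)
  have hcu : (letters u).card < 4 := by
    by_contra! hc
    exact hu fun S _ hS => satZeroS_of_four_le_card (inI_of_le hV S hS) hnu hc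
  have hcv : (letters v).card < 4 := by
    by_contra! hc
    exact hv fun S _ hS => satZeroS_of_four_le_card (inI_of_le hV S hS) hnv hc
  obtain ⟨x, s, hs⟩ := exists_eq_of_not_nodup hnu
  obtain ⟨y, t, ht⟩ := exists_eq_of_not_nodup hnv
  have hxy : x ≠ y := by
    rintro rfl
    rw [hs, ht] at huv hvu
    rw [hs, Multiset.card_cons, Multiset.card_cons] at hcu
    rw [ht, Multiset.card_cons, Multiset.card_cons] at hcv
    simp only [Multiset.cons_le_cons_iff] at huv hvu
    obtain ⟨a, rfl⟩ : ∃ a, s = {a} := Multiset.card_eq_one.1 (by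
      have : s.card ≠ 0 := fun h0 => huv (by simp [Multiset.card_eq_zero.1 h0])
      omega)
    obtain ⟨b, rfl⟩ : ∃ b, t = {b} := Multiset.card_eq_one.1 (by
      have : t.card ≠ 0 := fun h0 => hvu (by simp [Multiset.card_eq_zero.1 h0])
      omega)
    have hab : a ≠ b := fun hab => huv (by rw [hab])
    have ha := (hmem a).1 (by simp [hs])
    have hb := (hmem b).2 (by simp [ht])
    simp only [hs, ht, Multiset.mem_cons, Multiset.mem_singleton] at ha hb
    grind
  have hsy : y ∈ s := by
    have := (hmem y).2 (by simp [ht])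
    simpa [hs, hxy.symm] using this
  have htx : x ∈ t := by
    have := (hmem x).1 (by simp [hs])
    simpa [ht, hxy] using this
  obtain ⟨s', rfl⟩ := Multiset.exists_cons_of_mem hsy
  obtain ⟨t', rfl⟩ := Multiset.exists_cons_of_mem htx
  obtain rfl : s' = 0 := by
    rw [hs] at hcu
    simpa [Multiset.card_eq_zero] using (show s'.card = 0 by simp at hcu; omega)
  obtain rfl : t' = 0 := by
    rw [ht] at hcv
    simpa [Multiset.card_eq_zero] using (show t'.card = 0 by simp at hcv; omega)
  refine hI (mem_th_Ivar_iff.2 fun S _ hS => lift_xxy_eq hS (x := x) (y := y) hs ?_)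
  rw [ht, Multiset.cons_swap y x, Multiset.cons_swap y x]
  rfl

/-- A subvariety of `I` is determined by the test words vanishing in it. -/
theorem le_of_vSatZero {V W : SgVariety} (hV : V ≤ Ivar) (hW : W ≤ Ivar)
    (h : ∀ w, IsTestWord w → VSatZero V w → VSatZero W w) : W ≤ V := by
  have h' : ∀ u, VSatZero V u → VSatZero W u := by
    intro u hu
    obtain ⟨w, hw, hiff⟩ := exists_isTestWord u
    have hWw := h w hw fun S _ hS => (hiff S (inI_of_le hV S hS)).1 (hu S hS)
    exact fun S _ hS => (hiff S (inI_of_le hW S hS)).2 (hWw S hS)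
  rintro ⟨u, v⟩ he
  obtain hI | hu := mem_th_Ivar_or_vSatZero hV he
  · exact hW hI
  · exact mem_th_iff.2 fun S _ hS σ =>
      (h' u hu S hS).lift_eq (h' v (hu.of_mem_th he) S hS) σ σ

/-- A subvariety of `I` whose vanishing nonlinear test words are exactly the consequences of
`c = 0` is defined by `c = 0`, possibly together with nilpotency. -/
theorem eq_varOf_or_exists_eq_varOf {V : SgVariety} (hV : V ≤ Ivar) {E : Set SgId} {c : Word}
    (hE : ∀ {S : Type} [Semigroup S], Models S E ↔ InI S ∧ SatZeroS S c) (hc : VSatZero V c)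
    (hnl : ∀ w, w = w_xx ∨ w = w_xxx ∨ w = w_xxy → VSatZero V w →
      ∀ (S : Type) [Semigroup S], InI S → SatZeroS S c → SatZeroS S w) :
    V = varOf E ∨ ∃ n, 1 ≤ n ∧ VSatZero V (xprodTo n) ∧
      V = varOf (E ∪ zeroPair (xprodTo n) n) := by
  have hVE : ∀ (S : Type) [Semigroup S], Models S V.th → Models S E := fun S _ hS =>
    hE.2 ⟨inI_of_le hV S hS, hc S hS⟩
  by_cases hex : ∃ n, 1 ≤ n ∧ VSatZero V (xprodTo n)
  · classical
    obtain ⟨hN, hP⟩ := Nat.find_spec hex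
    have hmin : ∀ n, 1 ≤ n → VSatZero V (xprodTo n) → Nat.find hex ≤ n := fun n h1 h2 =>
      Nat.find_min' hex ⟨h1, h2⟩
    set N := Nat.find hex
    have hmod : ∀ {S : Type} [Semigroup S], Models S (varOf (E ∪ zeroPair (xprodTo N) N)).th →
        (InI S ∧ SatZeroS S c) ∧ SatZeroS S (xprodTo N) := fun {S} _ hS => by
      rwa [varOf, models_eqTh, models_union_xprodTo hN, hE] at hS
    refine .inr ⟨N, hN, hP, le_antisymm ?_ (le_of_vSatZero hV ?_ ?_)⟩
    · exact le_varOf_iff.2 fun S _ hS => (models_union_xprodTo hN).2 ⟨hVE S hS, hP S hS⟩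
    · exact le_varOf_iff.2 fun S _ hS => models_I.2 (hmod hS).1.1
    · intro w hw hVw S _ hS
      obtain ⟨⟨hI, hSc⟩, hSN⟩ := hmod hS
      cases hw with
      | xxyz => exact hI.zero
      | xprodTo n hn => exact satZeroS_xprodTo_of_le hI.comm hN (hmin n hn hVw) hSN
      | _ => exact hnl _ (by simp) hVw S hI hSc
  · have hmod : ∀ {S : Type} [Semigroup S], Models S (varOf E).th → InI S ∧ SatZeroS S c :=
      fun {S} _ hS => by rwa [varOf, models_eqTh, hE] at hS
    refine .inl (le_antisymm (le_varOf_iff.2 hVE) (le_of_vSatZero hV ?_ ?_))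
    · exact le_varOf_iff.2 fun S _ hS => models_I.2 (hmod hS).1
    · intro w hw hVw S _ hS
      obtain ⟨hI, hSc⟩ := hmod hS
      cases hw with
      | xxyz => exact hI.zero
      | xprodTo n hn => exact absurd ⟨n, hn, hVw⟩ hex
      | _ => exact hnl _ (by simp) hVw S hI hSc

end Subvarieties

/-! ### Semigroups separating `I` from its proper subvarieties -/

section Separation

open Word

/-- The monogenic semigroup `{a, a², a³, 0}` with `a⁴ = 0`; the number `i ≠ 0` stands for `aⁱ`. -/
def Monogenic4 : Type := Fin 4

/-- Multiplication of `Monogenic4`. -/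
def Monogenic4.mul (a b : Fin 4) : Fin 4 :=
  if h : a ≠ 0 ∧ b ≠ 0 ∧ a.val + b.val < 4 then ⟨a.val + b.val, h.2.2⟩ else 0

instance : Semigroup Monogenic4 where
  mul := Monogenic4.mul
  mul_assoc := show ∀ a b c : Fin 4, Monogenic4.mul (Monogenic4.mul a b) c =
    Monogenic4.mul a (Monogenic4.mul b c) by decide

theorem inI_monogenic4 : InI Monogenic4 where
  comm := show ∀ a b : Fin 4, Monogenic4.mul a b = Monogenic4.mul b a by decide
  satQ σ := (show ∀ a b : Fin 4, Monogenic4.mul (Monogenic4.mul a a) b =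
    Monogenic4.mul (Monogenic4.mul a b) b by decide) (σ 0) (σ 1)
  zero σ d := by
    have h0 : FreeSemigroup.lift σ w_xxyz = (0 : Fin 4) :=
      (show ∀ a b c : Fin 4, Monogenic4.mul (Monogenic4.mul (Monogenic4.mul a a) b) c = 0 by
        decide) (σ 0) (σ 1) (σ 2)
    rw [h0]
    exact (show ∀ d : Fin 4, Monogenic4.mul 0 d = 0 ∧ Monogenic4.mul d 0 = 0 by decide) d

theorem not_vSatZero_Ivar_xxx : ¬ VSatZero Ivar w_xxx := fun h =>
  absurd (h Monogenic4 (models_eqTh.2 (models_I.2 inI_monogenic4))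
    (fun _ => (1 : Fin 4)) (0 : Fin 4)).1
    (show ¬ Monogenic4.mul (Monogenic4.mul (Monogenic4.mul 1 1) 1) 0 =
      Monogenic4.mul (Monogenic4.mul 1 1) 1 by decide)

/-- The semigroup of finite sets under disjoint union, where `∅` is the zero and products of sets
that meet are zero. -/
def DisjointUnion : Type := Finset ℕ

/-- Multiplication of `DisjointUnion`. -/
def DisjointUnion.mul (s t : Finset ℕ) : Finset ℕ :=
  if s.Nonempty ∧ t.Nonempty ∧ Disjoint s t then s ∪ t else ∅

theorem DisjointUnion.mul_assoc (s t r : Finset ℕ) : mul (mul s t) r = mul s (mul t r) := by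
  unfold mul
  by_cases hs : s.Nonempty <;> by_cases ht : t.Nonempty <;> by_cases hr : r.Nonempty <;>
    by_cases hst : Disjoint s t <;> by_cases hsr : Disjoint s r <;>
    by_cases htr : Disjoint t r <;> simp [*]

theorem DisjointUnion.mul_comm (s t : Finset ℕ) : mul s t = mul t s := by
  simp only [mul, Finset.union_comm s t, disjoint_comm (a := s)]
  grind

theorem DisjointUnion.empty_mul (s : Finset ℕ) : mul ∅ s = ∅ := by simp [mul]

theorem DisjointUnion.mul_empty (s : Finset ℕ) : mul s ∅ = ∅ := by simp [mul]

theorem DisjointUnion.mul_self (s : Finset ℕ) : mul s s = ∅ := by simp [mul]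

instance : Semigroup DisjointUnion where
  mul := DisjointUnion.mul
  mul_assoc := DisjointUnion.mul_assoc

theorem satZeroS_disjointUnion_xx : SatZeroS DisjointUnion w_xx := by
  intro σ a
  have h : FreeSemigroup.lift σ w_xx = (∅ : Finset ℕ) := DisjointUnion.mul_self (σ 0)
  rw [h]
  exact ⟨DisjointUnion.empty_mul a, DisjointUnion.mul_empty a⟩

theorem inI_disjointUnion : InI DisjointUnion :=
  inI_of_satZeroS_xxy DisjointUnion.mul_comm
    (satZeroS_xxy_of_xx DisjointUnion.mul_comm satZeroS_disjointUnion_xx)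

theorem lift_xprodTo_disjointUnion (n : ℕ) :
    FreeSemigroup.lift (β := DisjointUnion) (fun k => ({k} : Finset ℕ)) (xprodTo (n + 1)) =
      Finset.range (n + 1) := by
  induction n with
  | zero => rfl
  | succ n ih =>
    rw [xprodTo, map_mul, ih]
    change DisjointUnion.mul (Finset.range (n + 1)) {n + 1} = _
    rw [DisjointUnion.mul, if_pos (by simp), Finset.range_add_one (n := n + 1),
      Finset.union_comm, ← Finset.insert_eq]

theorem not_vSatZero_Ivar_xprodTo {n : ℕ} (hn : 1 ≤ n) : ¬ VSatZero Ivar (xprodTo n) := by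
  intro h
  obtain ⟨m, rfl⟩ := Nat.exists_eq_add_of_le' hn
  have h1 := (h DisjointUnion (models_eqTh.2 (models_I.2 inI_disjointUnion))
    (fun k => ({k} : Finset ℕ)) (∅ : Finset ℕ)).1
  rw [lift_xprodTo_disjointUnion] at h1
  have h2 : (∅ : Finset ℕ) = Finset.range (m + 1) :=
    (DisjointUnion.mul_empty (Finset.range (m + 1))).symm.trans h1
  exact Finset.notMem_empty 0 (h2 ▸ Finset.mem_range.2 m.succ_pos)

theorem varOf_le_Ivar_and_ne {E : Set SgId} {w : Word} (hw : ¬ VSatZero Ivar w)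
    (hE : ∀ (S : Type) [Semigroup S], Models S E → InI S ∧ SatZeroS S w) :
    varOf E ≤ Ivar ∧ varOf E ≠ Ivar := by
  refine ⟨le_varOf_iff.2 fun S _ hS => models_I.2 (hE S (models_eqTh.1 hS)).1, fun he => hw ?_⟩
  rw [← he]
  exact fun S _ hS => (hE S (models_eqTh.1 hS)).2

end Separation

/-- The proper subvarieties of
`I = var{x²y = xy², x²yz = 0, xy = yx}` are exactly the varieties
`I_n` (`n ≥ 4`), `J`, `J_n` (`n ≥ 4`), `K`, `K_n` (`n ≥ 3`), `L`,
`L_n` (`n ≥ 1`). -/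
theorem proper_subvarieties_of_I (V : SgVariety) :
    (V ≤ Ivar ∧ V ≠ Ivar) ↔
      ((∃ n : ℕ, 4 ≤ n ∧ V = Ivarn n) ∨
        V = Jvar ∨
        (∃ n : ℕ, 4 ≤ n ∧ V = Jvarn n) ∨
        V = Kvar ∨
        (∃ n : ℕ, 3 ≤ n ∧ V = Kvarn n) ∨
        V = Lvar ∨
        (∃ n : ℕ, 1 ≤ n ∧ V = Lvarn n)) := by
  constructor
  · rintro ⟨hV, hne⟩
    have hI : ∀ (S : Type) [Semigroup S], Models S V.th → InI S := inI_of_le hV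
    by_cases hxx : VSatZero V w_xx
    · obtain h | ⟨n, hn, -, h⟩ := eq_varOf_or_exists_eq_varOf hV models_L hxx (by
        rintro w (rfl | rfl | rfl) - S _ hS h
        · exact h
        · exact satZeroS_xxx_of_xxy hS.comm (satZeroS_xxy_of_xx hS.comm h)
        · exact satZeroS_xxy_of_xx hS.comm h)
      · exact .inr (.inr (.inr (.inr (.inr (.inl h)))))
      · exact .inr (.inr (.inr (.inr (.inr (.inr ⟨n, hn, h⟩)))))
    by_cases hxxy : VSatZero V w_xxy
    · obtain h | ⟨n, hn, hP, h⟩ := eq_varOf_or_exists_eq_varOf hV models_K hxxy (by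
        rintro w (rfl | rfl | rfl) hw S _ hS h
        · exact absurd hw hxx
        · exact satZeroS_xxx_of_xxy hS.comm h
        · exact h)
      · exact .inr (.inr (.inr (.inl h)))
      · refine .inr (.inr (.inr (.inr (.inl ⟨n, ?_, h⟩))))
        by_contra! hlt
        exact hxx fun S _ hS =>
          satZeroS_xx_of_xprodTo (hI S hS).comm hn (Nat.le_of_lt_succ hlt) (hP S hS)
    have h4 : ∀ n, 1 ≤ n → VSatZero V (xprodTo n) → 4 ≤ n := by
      intro n hn hP
      by_contra! hlt
      exact hxxy fun S _ hS =>
        satZeroS_xxy_of_xprodTo (hI S hS).comm hn (Nat.le_of_lt_succ hlt) (hP S hS)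
    by_cases hxxx : VSatZero V w_xxx
    · obtain h | ⟨n, hn, hP, h⟩ := eq_varOf_or_exists_eq_varOf hV models_J hxxx (by
        rintro w (rfl | rfl | rfl) hw S _ hS h
        · exact absurd hw hxx
        · exact h
        · exact absurd hw hxxy)
      · exact .inr (.inl h)
      · exact .inr (.inr (.inl ⟨n, h4 n hn hP, h⟩))
    · obtain h | ⟨n, hn, hP, h⟩ := eq_varOf_or_exists_eq_varOf hV (c := w_xxyz)
        (models_I.trans ⟨fun h => ⟨h, h.zero⟩, And.left⟩) (fun S _ hS => (hI S hS).zero) (by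
          rintro w (rfl | rfl | rfl) hw
          · exact absurd hw hxx
          · exact absurd hw hxxx
          · exact absurd hw hxxy)
      · exact absurd h hne
      · exact .inl ⟨n, h4 n hn hP, h⟩
  · rintro (⟨n, hn, rfl⟩ | rfl | ⟨n, hn, rfl⟩ | rfl | ⟨n, hn, rfl⟩ | rfl | ⟨n, hn, rfl⟩)
    · have h1 : 1 ≤ n := by omega
      refine varOf_le_Ivar_and_ne (not_vSatZero_Ivar_xprodTo h1) fun S _ hS => ?_
      rwa [models_union_xprodTo h1, models_I] at hS
    · exact varOf_le_Ivar_and_ne not_vSatZero_Ivar_xxx fun S _ hS => models_J.1 hS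
    · refine varOf_le_Ivar_and_ne not_vSatZero_Ivar_xxx fun S _ hS => ?_
      exact models_J.1 (models_union.1 hS).1
    · refine varOf_le_Ivar_and_ne not_vSatZero_Ivar_xxx fun S _ hS => ?_
      obtain ⟨hI, h⟩ := models_K.1 hS
      exact ⟨hI, satZeroS_xxx_of_xxy hI.comm h⟩
    · refine varOf_le_Ivar_and_ne not_vSatZero_Ivar_xxx fun S _ hS => ?_
      obtain ⟨hI, h⟩ := models_K.1 (models_union.1 hS).1
      exact ⟨hI, satZeroS_xxx_of_xxy hI.comm h⟩
    · refine varOf_le_Ivar_and_ne not_vSatZero_Ivar_xxx fun S _ hS => ?_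
      obtain ⟨hI, h⟩ := models_L.1 hS
      exact ⟨hI, satZeroS_xxx_of_xxy hI.comm (satZeroS_xxy_of_xx hI.comm h)⟩
    · refine varOf_le_Ivar_and_ne not_vSatZero_Ivar_xxx fun S _ hS => ?_
      obtain ⟨hI, h⟩ := models_L.1 (models_union.1 hS).1
      exact ⟨hI, satZeroS_xxx_of_xxy hI.comm (satZeroS_xxy_of_xx hI.comm h)⟩
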